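/- B is a subring of A; the operation a ↼ r := χ(i(a)·r) makes A a right R-module, and b·(a ↼ r) = (b·a) ↼ r for all b ∈ B, a ∈ A, r ∈ R (so A is a (B,R)-bimodule); Q is a left ideal of R and q·i(b) ∈ Q for all q ∈ Q, b ∈ B; χ(i(a)·q) ∈ B for all a ∈ A, q ∈ Q; and the Morita compatibility identities hold: χ(i(a)·q·i(a')) = χ(i(a)·q)·a' and q·i(a)·q' = q·i(χ(i(a)·q')) for all a, a' ∈ A and q, q' ∈ Q. (These are the data of the Morita context (B, R, A, Q, τ, μ) with τ(a ⊗ q) = χ(i(a)·q) and μ(q ⊗ a) = q·i(a).) -/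

import Mathlib

/-!
Morita context data associated to a ring morphism `i : A → R` and a map `χ : R → A`
which is right `A`-linear, satisfies `χ (i (χ r) * s) = χ (r * s)` and `χ 1 = 1`.
Here `B = {b : A | ∀ r, b * χ r = χ (i b * r)}` and `Q = {q : R | ∀ r, q * r = q * i (χ r)}`.
-/

theorem morita_context_data
    {A R : Type*} [Ring A] [Ring R] (i : A →+* R) (χ : R → A)
    (hadd : ∀ r s : R, χ (r + s) = χ r + χ s)
    (h1 : ∀ (r : R) (a : A), χ (r * i a) = χ r * a)
    (h2 : ∀ r s : R, χ (i (χ r) * s) = χ (r * s))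
    (h3 : χ 1 = 1)
    (B : Set A) (hB : B = {b : A | ∀ r : R, b * χ r = χ (i b * r)})
    (Q : Set R) (hQ : Q = {q : R | ∀ r : R, q * r = q * i (χ r)}) :
    -- B is a subring of A
    (∃ S : Subring A, (S : Set A) = B) ∧
    -- a ↼ r := χ (i a * r) makes A a right R-module
    (∀ a : A, χ (i a * 1) = a) ∧
    (∀ (a : A) (r s : R), χ (i (χ (i a * r)) * s) = χ (i a * (r * s))) ∧
    (∀ (a a' : A) (r : R), χ (i (a + a') * r) = χ (i a * r) + χ (i a' * r)) ∧
    (∀ (a : A) (r s : R), χ (i a * (r + s)) = χ (i a * r) + χ (i a * s)) ∧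
    -- A is a (B,R)-bimodule: b·(a ↼ r) = (b·a) ↼ r
    (∀ b ∈ B, ∀ (a : A) (r : R), b * χ (i a * r) = χ (i (b * a) * r)) ∧
    -- Q is a left ideal of R
    ((0 : R) ∈ Q) ∧
    (∀ q ∈ Q, ∀ q' ∈ Q, q + q' ∈ Q) ∧
    (∀ q ∈ Q, -q ∈ Q) ∧
    (∀ (r : R), ∀ q ∈ Q, r * q ∈ Q) ∧
    -- Q is a right B-module: q·i(b) ∈ Q
    (∀ q ∈ Q, ∀ b ∈ B, q * i b ∈ Q) ∧
    -- τ takes values in B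
    (∀ (a : A), ∀ q ∈ Q, χ (i a * q) ∈ B) ∧
    -- Morita compatibility identities
    (∀ (a a' : A), ∀ q ∈ Q, χ (i a * q * i a') = χ (i a * q) * a') ∧
    (∀ (a : A), ∀ q ∈ Q, ∀ q' ∈ Q, q * i a * q' = q * i (χ (i a * q'))) := by
  subst hB hQ
  have hzero : χ 0 = 0 := by simpa using hadd 0 0
  have hneg (r : R) : χ (-r) = -χ r :=
    eq_neg_of_add_eq_zero_left (by rw [← hadd, neg_add_cancel, hzero])
  have hi (a : A) : χ (i a) = a := by simpa [h3] using h1 1 a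
  refine ⟨⟨{ carrier := {b : A | ∀ r : R, b * χ r = χ (i b * r)}
             mul_mem' := fun {b b'} hb hb' r => ?_
             one_mem' := fun r => by simp
             add_mem' := fun {b b'} hb hb' r => ?_
             zero_mem' := fun r => by simp [hzero]
             neg_mem' := fun {b} hb r => ?_ }, rfl⟩,
    fun a => by rw [mul_one, hi], fun a r s => by rw [h2, mul_assoc],
    fun a a' r => by rw [map_add, add_mul, hadd], fun a r s => by rw [mul_add, hadd],
    fun b hb a r => by rw [hb, map_mul, mul_assoc], fun r => by simp,
    fun q hq q' hq' r => by rw [add_mul, add_mul, hq r, hq' r],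
    fun q hq r => by rw [neg_mul, neg_mul, hq r],
    fun r q hq s => by rw [mul_assoc, mul_assoc, hq s],
    fun q hq b hb r => by rw [mul_assoc, hq, ← hb r, map_mul, mul_assoc],
    fun a q hq r => by rw [← h1, h2, mul_assoc, ← hq r, mul_assoc],
    fun a a' q _ => h1 _ _, fun a q hq q' _ => by rw [mul_assoc, hq]⟩
  · rw [mul_assoc, hb', hb, map_mul, mul_assoc]
  · rw [add_mul, hb, hb', map_add, add_mul, hadd]
  · rw [neg_mul, hb, map_neg, neg_mul, hneg]
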